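/- Let y = v_j be a vertex, x ∈ [v_1, v_n] a point with y < x, and i an index with j < i and v_i < x. For w ∈ [w_i^−, w_i^+], let ρ_x(w) denote the head of the left cluster for x containing v_i under the scenario s(i, w), and let ρ_y(w) denote the head of the right cluster for y containing v_i under s(i, w). Then ρ_x(w) and ρ_y(w) are constant functions of w on [w_i^−, w_i^+]. -/

import Mathlib

open Finset
open scoped Classical

namespace DPN

noncomputable def score (τ c : ℝ) (v w : ℕ → ℝ) (h r j : ℕ) : ℝ :=
  τ * (v h - v j) + (∑ l ∈ Finset.Ioc r j, w l) / c

noncomputable def nextHead (τ c : ℝ) (v w : ℕ → ℝ) (h r : ℕ) : ℕ :=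
  (((Finset.Ioc r h).filter (fun j =>
      ∀ j' ∈ Finset.Ioc r h, score τ c v w h r j' ≤ score τ c v w h r j)).max).getD h

noncomputable def heads (τ c : ℝ) (v w : ℕ → ℝ) (h : ℕ) : ℕ → ℕ
  | 0 => 0
  | m + 1 => nextHead τ c v w h (heads τ c v w h m)

noncomputable def hIdx (n : ℕ) (v : ℕ → ℝ) (x : ℝ) : ℕ :=
  ((Finset.Icc 1 n).filter (fun i => v i < x)).card

noncomputable def phiL (n : ℕ) (τ c : ℝ) (v w : ℕ → ℝ) (x : ℝ) : ℝ :=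
  ∑ m ∈ Finset.range n,
    ((∑ l ∈ Finset.Ioc (heads τ c v w (hIdx n v x) m) (heads τ c v w (hIdx n v x) (m + 1)), w l) *
        (τ * (x - v (heads τ c v w (hIdx n v x) (m + 1)))) +
      (∑ l ∈ Finset.Ioc (heads τ c v w (hIdx n v x) m) (heads τ c v w (hIdx n v x) (m + 1)), w l) ^ 2 /
        (2 * c))

def rv (n : ℕ) (v : ℕ → ℝ) : ℕ → ℝ := fun l => -v (n + 1 - l)

def rw (n : ℕ) (w : ℕ → ℝ) : ℕ → ℝ := fun l => w (n + 1 - l)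

noncomputable def phiR (n : ℕ) (τ c : ℝ) (v w : ℕ → ℝ) (x : ℝ) : ℝ :=
  phiL n τ c (rv n v) (rw n w) (-x)

noncomputable def phi (n : ℕ) (τ c : ℝ) (v w : ℕ → ℝ) (x : ℝ) : ℝ :=
  phiL n τ c v w x + phiR n τ c v w x

/-- The set of scenarios: each vertex weight lies in its interval. -/
def scenarios (n : ℕ) (wm wp : ℕ → ℝ) : Set (ℕ → ℝ) :=
  {s | ∀ i, 1 ≤ i → i ≤ n → wm i ≤ s i ∧ s i ≤ wp i}

/-- The gap `Γ^s(x, y) = Φ^s(x) − Φ^s(y)`. -/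
noncomputable def gap (n : ℕ) (τ c : ℝ) (v s : ℕ → ℝ) (x y : ℝ) : ℝ :=
  phi n τ c v s x - phi n τ c v s y

/-- The regret `R^s(x) = Φ^s(x) − Φ^s(m^s)` (`Φ^s(m^s)` = min of `Φ^s` on `[v_1, v_n]`). -/
noncomputable def regret (n : ℕ) (τ c : ℝ) (v s : ℕ → ℝ) (x : ℝ) : ℝ :=
  phi n τ c v s x - sInf ((fun z => phi n τ c v s z) '' Set.Icc (v 1) (v n))

/-- The maximum regret `R_max(x) = sup_{s ∈ S} R^s(x)`. -/
noncomputable def maxRegret (n : ℕ) (τ c : ℝ) (v wm wp : ℕ → ℝ) (x : ℝ) : ℝ :=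
  sSup {r | ∃ s ∈ scenarios n wm wp, r = regret n τ c v s x}

/-- The left-pseudo-bipartite scenario `s(i, w)`. -/
def pseudoBipL (wm wp : ℕ → ℝ) (i : ℕ) (w : ℝ) : ℕ → ℝ :=
  fun l => if l < i then wp l else if l = i then w else wm l

/-- The right-pseudo-bipartite scenario `s(i, w)`. -/
def pseudoBipR (wm wp : ℕ → ℝ) (i : ℕ) (w : ℝ) : ℕ → ℝ :=
  fun l => if l < i then wm l else if l = i then w else wp l

/-- The head `ρ_m` of the left cluster containing vertex `i`: the smallest cluster head `≥ i`. -/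
noncomputable def clusterHeadOf (τ c : ℝ) (v w : ℕ → ℝ) (h i : ℕ) : ℕ :=
  ((((Finset.range (h + 1)).image (heads τ c v w h)).filter (fun r => i ≤ r)).min).getD h

/-- The head `ρ_{m−1}` preceding the left cluster containing vertex `i`:
the largest cluster head `< i`. -/
noncomputable def prevClusterHeadOf (τ c : ℝ) (v w : ℕ → ℝ) (h i : ℕ) : ℕ :=
  ((((Finset.range (h + 1)).image (heads τ c v w h)).filter (fun r => r < i)).max).getD 0

/-- The weight `σ_m` of the left cluster containing vertex `i`. -/
noncomputable def clusterWeightOf (τ c : ℝ) (v w : ℕ → ℝ) (h i : ℕ) : ℝ :=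
  ∑ l ∈ Finset.Ioc (prevClusterHeadOf τ c v w h i) (clusterHeadOf τ c v w h i), w l

/-- The sequence of right cluster heads for the vertex `y = v_j`
(expressed in the coordinates of the reflected network). -/
noncomputable def rightHeads (n : ℕ) (τ c : ℝ) (v w : ℕ → ℝ) (j : ℕ) : ℕ → ℕ :=
  heads τ c (rv n v) (rw n w) (hIdx n (rv n v) (-(v j)))

/-- The sequence of left cluster heads for the vertex `y = v_j`. -/
noncomputable def leftHeads (n : ℕ) (τ c : ℝ) (v w : ℕ → ℝ) (j : ℕ) : ℕ → ℕ :=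
  heads τ c v w (hIdx n v (v j))

/-- The (original-coordinates) index of the head of the right cluster for `y = v_j`
containing vertex `i`. -/
noncomputable def rightClusterHeadOf (n : ℕ) (τ c : ℝ) (v w : ℕ → ℝ) (j i : ℕ) : ℕ :=
  n + 1 - clusterHeadOf τ c (rv n v) (rw n w) (hIdx n (rv n v) (-(v j))) (n + 1 - i)

/-- The weight of the right cluster for `y = v_j` containing vertex `i`. -/
noncomputable def rightClusterWeightOf (n : ℕ) (τ c : ℝ) (v w : ℕ → ℝ) (j i : ℕ) : ℝ :=
  clusterWeightOf τ c (rv n v) (rw n w) (hIdx n (rv n v) (-(v j))) (n + 1 - i)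

/-- `ω` is a critical weight for `v_i` with respect to the vertex `y = v_j`
(left-pseudo-bipartite case): `ω ∈ {w_i^−, w_i^+}` or the right-cluster partition for `y`
under `s(i, ·)` is not constant on any neighborhood of `ω` in `[w_i^−, w_i^+]`. -/
def criticalWeightL (n : ℕ) (τ c : ℝ) (v wm wp : ℕ → ℝ) (j i : ℕ) (ω : ℝ) : Prop :=
  ω ∈ Set.Icc (wm i) (wp i) ∧
    (ω = wm i ∨ ω = wp i ∨
      ¬ ∃ ε > (0 : ℝ), ∀ w ∈ Set.Icc (wm i) (wp i), |w - ω| < ε →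
        rightHeads n τ c v (pseudoBipL wm wp i w) j =
          rightHeads n τ c v (pseudoBipL wm wp i ω) j)

/-- `ω` is a critical weight for `v_i` with respect to the vertex `y = v_j`
(right-pseudo-bipartite case, using the left-cluster partition for `y`). -/
def criticalWeightR (n : ℕ) (τ c : ℝ) (v wm wp : ℕ → ℝ) (j i : ℕ) (ω : ℝ) : Prop :=
  ω ∈ Set.Icc (wm i) (wp i) ∧
    (ω = wm i ∨ ω = wp i ∨
      ¬ ∃ ε > (0 : ℝ), ∀ w ∈ Set.Icc (wm i) (wp i), |w - ω| < ε →
        leftHeads n τ c v (pseudoBipR wm wp i w) j =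
          leftHeads n τ c v (pseudoBipR wm wp i ω) j)

/-- `Q`: the number of right clusters for `y = v_j` under weights `w` that lie entirely
to the right of the right cluster containing `v_i` (counted via reflected cluster heads). -/
noncomputable def Qnum (n : ℕ) (τ c : ℝ) (v w : ℕ → ℝ) (j i : ℕ) : ℕ :=
  (((Finset.range (n + 1)).image (rightHeads n τ c v w j)).filter
      (fun r => 1 ≤ r ∧
        r < clusterHeadOf τ c (rv n v) (rw n w) (hIdx n (rv n v) (-(v j))) (n + 1 - i))).card

end DPN

open DPN

namespace DPN

/-- The next head after `r < h` is the last maximizer of the score on `(r, h]`. -/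
theorem nextHead_eq_iff {τ c : ℝ} {v w : ℕ → ℝ} {h r k : ℕ} (hr : r < h) :
    nextHead τ c v w h r = k ↔ k ∈ Finset.Ioc r h ∧ ∀ j ∈ Finset.Ioc r h,
      score τ c v w h r j ≤ score τ c v w h r k ∧
        (k < j → score τ c v w h r j < score τ c v w h r k) := by
  have spec : nextHead τ c v w h r ∈ Finset.Ioc r h ∧ ∀ j ∈ Finset.Ioc r h,
      score τ c v w h r j ≤ score τ c v w h r (nextHead τ c v w h r) ∧
        (nextHead τ c v w h r < j →
          score τ c v w h r j < score τ c v w h r (nextHead τ c v w h r)) := by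
    obtain ⟨a, ha, hmax⟩ := Finset.exists_max_image (Finset.Ioc r h)
      (score τ c v w h r) ⟨h, by simp [hr]⟩
    obtain ⟨b, hb⟩ := Finset.max_of_mem (s := (Finset.Ioc r h).filter fun j =>
      ∀ j' ∈ Finset.Ioc r h, score τ c v w h r j' ≤ score τ c v w h r j)
      (Finset.mem_filter.2 ⟨ha, hmax⟩)
    have hnext : nextHead τ c v w h r = b := by
      unfold nextHead
      rw [hb]
      rfl
    rw [hnext]
    obtain ⟨hbI, hbmax⟩ := Finset.mem_filter.1 (Finset.mem_of_max hb)
    refine ⟨hbI, fun j hj => ⟨hbmax j hj, fun hlt => ?_⟩⟩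
    by_contra! hle
    exact absurd (Finset.le_max_of_eq
      (Finset.mem_filter.2 ⟨hj, fun l hl => (hbmax l hl).trans hle⟩) hb) (by omega)
  constructor
  · rintro rfl
    exact spec
  · rintro ⟨hk, hkmax⟩
    rcases lt_trichotomy (nextHead τ c v w h r) k with hlt | heq | hgt
    · exact absurd ((spec.2 k hk).2 hlt) (hkmax _ spec.1).1.not_gt
    · exact heq
    · exact absurd ((hkmax _ spec.1).2 hgt) (spec.2 k hk).1.not_gt

theorem nextHead_mem {τ c : ℝ} {v w : ℕ → ℝ} {h r : ℕ} (hr : r < h) :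
    nextHead τ c v w h r ∈ Finset.Ioc r h :=
  ((nextHead_eq_iff hr).1 rfl).1

theorem nextHead_of_le {τ c : ℝ} {v w : ℕ → ℝ} {h r : ℕ} (hr : h ≤ r) :
    nextHead τ c v w h r = h := by
  unfold nextHead
  rw [Finset.Ioc_eq_empty_of_le hr]
  rfl

theorem score_eq_add (τ c : ℝ) (v w : ℕ → ℝ) (h : ℕ) {r s j : ℕ} (hrs : r ≤ s) (hsj : s ≤ j) :
    score τ c v w h r j = score τ c v w h s j + (∑ l ∈ Finset.Ioc r s, w l) / c := by
  unfold score
  rw [← Finset.sum_Ioc_consecutive w hrs hsj]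
  ring

/-- Starting the search anywhere inside a cluster leads to the same head. -/
theorem nextHead_eq_of_le_of_lt {τ c : ℝ} {v w : ℕ → ℝ} {h r s : ℕ} (hr : r < h) (hrs : r ≤ s)
    (hs : s < nextHead τ c v w h r) : nextHead τ c v w h s = nextHead τ c v w h r := by
  obtain ⟨hmem, hmax⟩ := (nextHead_eq_iff hr).1 (rfl : nextHead τ c v w h r = _)
  have hle := (Finset.mem_Ioc.1 hmem).2
  refine (nextHead_eq_iff (hs.trans_le hle)).2 ⟨Finset.mem_Ioc.2 ⟨hs, hle⟩, fun j hj => ?_⟩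
  obtain ⟨hsj, hjh⟩ := Finset.mem_Ioc.1 hj
  have := hmax j (Finset.mem_Ioc.2 ⟨hrs.trans_lt hsj, hjh⟩)
  rwa [score_eq_add τ c v w h hrs hsj.le, score_eq_add τ c v w h hrs hs.le,
    add_le_add_iff_right, add_lt_add_iff_right] at this

theorem heads_le (τ c : ℝ) (v w : ℕ → ℝ) (h m : ℕ) : heads τ c v w h m ≤ h := by
  cases m with
  | zero => exact Nat.zero_le h
  | succ m =>
    rcases lt_or_ge (heads τ c v w h m) h with hlt | hge
    · exact (Finset.mem_Ioc.1 (nextHead_mem hlt)).2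
    · exact (nextHead_of_le hge).le

theorem heads_monotone (τ c : ℝ) (v w : ℕ → ℝ) (h : ℕ) : Monotone (heads τ c v w h) := by
  refine monotone_nat_of_le_succ fun m => ?_
  rcases lt_or_ge (heads τ c v w h m) h with hlt | hge
  · exact (Finset.mem_Ioc.1 (nextHead_mem hlt)).1.le
  · exact (heads_le τ c v w h m).trans (nextHead_of_le hge).ge

theorem min_le_heads (τ c : ℝ) (v w : ℕ → ℝ) (h m : ℕ) : min m h ≤ heads τ c v w h m := by
  induction m with
  | zero => simp
  | succ m ih =>
    rcases lt_or_ge (heads τ c v w h m) h with hlt | hge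
    · have : heads τ c v w h m < heads τ c v w h (m + 1) :=
        (Finset.mem_Ioc.1 (nextHead_mem hlt)).1
      omega
    · have : heads τ c v w h (m + 1) = h := nextHead_of_le hge
      omega

theorem clusterHeadOf_of_lt {τ c : ℝ} {v w : ℕ → ℝ} {h i : ℕ} (hi : h < i) :
    clusterHeadOf τ c v w h i = h := by
  unfold clusterHeadOf
  rw [Finset.filter_eq_empty_iff.2]
  · rfl
  · intro r hr
    obtain ⟨m, -, rfl⟩ := Finset.mem_image.1 hr
    exact ((heads_le τ c v w h m).trans_lt hi).not_ge

/-- The head of the cluster of vertex `i + 1` is the next head found from `i`. -/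
theorem clusterHeadOf_succ {τ c : ℝ} {v w : ℕ → ℝ} {h i : ℕ} (hi : i < h) :
    clusterHeadOf τ c v w h (i + 1) = nextHead τ c v w h i := by
  have hex : ∃ m, i < heads τ c v w h m :=
    ⟨h, by have := min_le_heads τ c v w h h; omega⟩
  obtain ⟨m, hm⟩ : ∃ m, Nat.find hex = m + 1 :=
    Nat.exists_eq_succ_of_ne_zero fun h0 => by
      have := Nat.find_spec hex
      rw [h0] at this
      exact Nat.not_lt_zero _ this
  have hlt : i < heads τ c v w h (m + 1) := hm ▸ Nat.find_spec hex
  have hle : heads τ c v w h m ≤ i := not_lt.1 (Nat.find_min hex (by omega))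
  have hmh : m < h := by
    have := min_le_heads τ c v w h m
    omega
  have hmin : (((Finset.range (h + 1)).image (heads τ c v w h)).filter
      (fun r => i + 1 ≤ r)).min = (heads τ c v w h (m + 1) : WithTop ℕ) := by
    refine le_antisymm (Finset.min_le (Finset.mem_filter.2 ⟨Finset.mem_image.2
      ⟨m + 1, Finset.mem_range.2 (by omega), rfl⟩, hlt⟩)) (Finset.le_min fun r hr => ?_)
    obtain ⟨hr, hir⟩ := Finset.mem_filter.1 hr
    obtain ⟨k, -, rfl⟩ := Finset.mem_image.1 hr
    refine WithTop.coe_le_coe.2 (heads_monotone τ c v w h ?_)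
    by_contra! hk
    exact Nat.find_min hex (by omega) hir
  unfold clusterHeadOf
  rw [hmin]
  exact (nextHead_eq_of_le_of_lt (hle.trans_lt hi) hle hlt).symm

theorem nextHead_congr {τ c : ℝ} {v w w' : ℕ → ℝ} {h i : ℕ} (hi : i < h)
    (hw : ∀ l, i + 1 < l → w l = w' l) :
    nextHead τ c v w h i = nextHead τ c v w' h i := by
  have hscore : ∀ j, i + 1 ≤ j →
      score τ c v w h (i + 1) j = score τ c v w' h (i + 1) j := fun j _ => by
    unfold score
    rw [Finset.sum_congr rfl fun l hl => hw l (Finset.mem_Ioc.1 hl).1]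
  obtain ⟨hmem, hmax⟩ := (nextHead_eq_iff hi).1 (rfl : nextHead τ c v w' h i = _)
  refine (nextHead_eq_iff hi).2 ⟨hmem, fun j hj => ?_⟩
  have hk : i + 1 ≤ nextHead τ c v w' h i := (Finset.mem_Ioc.1 hmem).1
  have hj' : i + 1 ≤ j := (Finset.mem_Ioc.1 hj).1
  have := hmax j hj
  rw [score_eq_add τ c v w' h i.le_succ hj', score_eq_add τ c v w' h i.le_succ hk,
    add_le_add_iff_right, add_lt_add_iff_right] at this
  rwa [score_eq_add τ c v w h i.le_succ hj', score_eq_add τ c v w h i.le_succ hk,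
    add_le_add_iff_right, add_lt_add_iff_right, hscore j hj', hscore _ hk]

/-- The head of the cluster of vertex `i` depends only on the weights beyond `i`. -/
theorem clusterHeadOf_congr {τ c : ℝ} {v w w' : ℕ → ℝ} {h i : ℕ} (hi : 1 ≤ i)
    (hw : ∀ l, i < l → w l = w' l) :
    clusterHeadOf τ c v w h i = clusterHeadOf τ c v w' h i := by
  obtain ⟨i, rfl⟩ := Nat.exists_eq_add_of_le' hi
  rcases lt_or_ge i h with hlt | hge
  · rw [clusterHeadOf_succ hlt, clusterHeadOf_succ hlt, nextHead_congr hlt hw]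
  · rw [clusterHeadOf_of_lt (by omega), clusterHeadOf_of_lt (by omega)]

theorem pseudoBipL_congr {wm wp : ℕ → ℝ} {i l : ℕ} (w₁ w₂ : ℝ) (hl : l ≠ i) :
    pseudoBipL wm wp i w₁ l = pseudoBipL wm wp i w₂ l := by
  simp [pseudoBipL, hl]

end DPN

theorem stmt12 (n : ℕ) (τ c : ℝ) (hτ : 0 < τ) (hc : 0 < c) (v : ℕ → ℝ)
    (hv : ∀ i, 1 ≤ i → i < n → v i < v (i + 1))
    (wm wp : ℕ → ℝ) (hwm : ∀ i, 1 ≤ i → i ≤ n → 0 < wm i)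
    (hwmp : ∀ i, 1 ≤ i → i ≤ n → wm i ≤ wp i)
    (j : ℕ) (hj1 : 1 ≤ j) (hjn : j ≤ n)
    (x : ℝ) (hx : x ∈ Set.Icc (v 1) (v n)) (hyx : v j < x)
    (i : ℕ) (hji : j < i) (hin : i ≤ n) (hix : v i < x) :
    ∀ w₁ ∈ Set.Icc (wm i) (wp i), ∀ w₂ ∈ Set.Icc (wm i) (wp i),
      clusterHeadOf τ c v (pseudoBipL wm wp i w₁) (hIdx n v x) i =
          clusterHeadOf τ c v (pseudoBipL wm wp i w₂) (hIdx n v x) i ∧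
        rightClusterHeadOf n τ c v (pseudoBipL wm wp i w₁) j i =
          rightClusterHeadOf n τ c v (pseudoBipL wm wp i w₂) j i := by
  intro w₁ _ w₂ _
  refine ⟨clusterHeadOf_congr (by omega) fun l hl => pseudoBipL_congr w₁ w₂ hl.ne', ?_⟩
  exact congrArg (n + 1 - ·)
    (clusterHeadOf_congr (by omega) fun l hl => pseudoBipL_congr w₁ w₂ (by omega))
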